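/- arXiv:1712.10146 — 2 statements merged into one kernel-verified Lean document; each statement's English description precedes it below -/
import Mathlib

section
/- Let A be a commutative Noetherian ring, 𝔮 ⊆ A an ideal, M a finitely generated A-module, c ≥ 1 an integer, and a ∈ 𝔮^c an element that is a nonzerodivisor on M. Assume there exists an integer k such that (𝔮^{n+1+c}M :_M a) ∩ 𝔮^nM ⊆ 𝔮^{n+1}M for all n ≥ k. Then there exists an integer ℓ such that (𝔮^{n+c}M :_M a) = 𝔮^nM for all n ≥ ℓ. -/
/-- If `a ∈ 𝔮^c` is a nonzerodivisor on `M` whose initial form avoids the relevant associated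
primes of `G_M(𝔮)` (in the elementary form: `(𝔮^{n+1+c}M :_M a) ∩ 𝔮^nM ⊆ 𝔮^{n+1}M` for all
large `n`), then `(𝔮^{n+c}M :_M a) = 𝔮^nM` for all large `n`. -/
theorem colon_eq_of_initial_form_regular
    {A M : Type} [CommRing A] [IsNoetherianRing A] [AddCommGroup M] [Module A M]
    [Module.Finite A M] (𝔮 : Ideal A) (c : ℕ) (hc : 1 ≤ c) (a : A) (ha : a ∈ 𝔮 ^ c)
    (hreg : ∀ m : M, a • m = 0 → m = 0)
    (h : ∃ k : ℕ, ∀ n ≥ k,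
      Submodule.comap (a • (LinearMap.id : M →ₗ[A] M)) (𝔮 ^ (n + 1 + c) • ⊤) ⊓
        (𝔮 ^ n • ⊤) ≤ 𝔮 ^ (n + 1) • ⊤) :
    ∃ l : ℕ, ∀ n ≥ l,
      Submodule.comap (a • (LinearMap.id : M →ₗ[A] M)) (𝔮 ^ (n + c) • ⊤) = 𝔮 ^ n • ⊤ := by
  obtain ⟨k, hk⟩ := h
  obtain ⟨r, hr⟩ := 𝔮.exists_pow_inf_eq_pow_smul (LinearMap.range (a • (LinearMap.id : M →ₗ[A] M)))
  have hmono : ∀ {i j : ℕ}, i ≤ j → (𝔮 ^ j • ⊤ : Submodule A M) ≤ 𝔮 ^ i • ⊤ := fun hij =>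
    Submodule.smul_mono_left (Ideal.pow_le_pow_right hij)
  refine ⟨k + r, fun n hn => le_antisymm (fun m hm => ?_) (fun m hm => ?_)⟩
  · have hbase : m ∈ (𝔮 ^ k • ⊤ : Submodule A M) := by
      have hmem : a • m ∈ 𝔮 ^ (n + c) • ⊤ ⊓ LinearMap.range (a • (LinearMap.id : M →ₗ[A] M)) :=
        ⟨hm, m, rfl⟩
      rw [hr (n + c) (by omega)] at hmem
      have hmap := Submodule.smul_mono le_rfl inf_le_right hmem
      rw [LinearMap.range_eq_map, ← Submodule.map_smul''] at hmap
      obtain ⟨m', hm', heq⟩ := hmap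
      have heq' : a • m' = a • m := heq
      have : m' = m := sub_eq_zero.mp (hreg _ (by rw [smul_sub, heq', sub_self]))
      exact this ▸ hmono (by omega) hm'
    have hclimb : ∀ j, k ≤ j → j ≤ n → m ∈ (𝔮 ^ j • ⊤ : Submodule A M) := by
      intro j hkj
      induction j, hkj using Nat.le_induction with
      | base => exact fun _ => hbase
      | succ j hkj ih => exact fun hj => hk j hkj ⟨hmono (by omega) hm, ih (by omega)⟩
    exact hclimb n (by omega) le_rfl
  · change a • m ∈ (𝔮 ^ (n + c) • ⊤ : Submodule A M)
    rw [add_comm, pow_add, Submodule.mul_smul]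
    exact Submodule.smul_mem_smul ha hm
end

section
/- Let A be a commutative Noetherian ring, 𝔮 ⊆ A an ideal, M a finitely generated A-module, c ≥ 1 an integer, and a ∈ 𝔮^c. Then the following conditions are equivalent: (i) ⨆_{l≥0} (𝔮(𝔮^c)^lM :_M a^l) = M; (ii) for every k ≥ 1, ⨆_{l≥0} (𝔮^k(𝔮^c)^lM :_M a^l) = M; (iii) there exists k ≥ 1 with ⨆_{l≥0} (𝔮^k(𝔮^c)^lM :_M a^l) = M. -/
/-- The submodule `(𝔮^kM)^{aA} = ⨆_l (𝔮^k(𝔮^c)^lM :_M a^l)` of `M`. -/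
def qPowSaturation {A M : Type} [CommRing A] [AddCommGroup M] [Module A M]
    (𝔮 : Ideal A) (c : ℕ) (a : A) (k : ℕ) : Submodule A M :=
  ⨆ l : ℕ, Submodule.comap ((a ^ l) • (LinearMap.id : M →ₗ[A] M))
    ((𝔮 ^ k * (𝔮 ^ c) ^ l) • ⊤)

theorem comap_pow_smul_monotone {A M : Type} [CommRing A] [AddCommGroup M] [Module A M]
    (I J : Ideal A) {a : A} (ha : a ∈ J) :
    Monotone fun l : ℕ => Submodule.comap ((a ^ l) • (LinearMap.id : M →ₗ[A] M))
      ((I * J ^ l) • ⊤) := by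
  refine monotone_nat_of_le_succ fun l m hm => ?_
  simp only [Submodule.mem_comap, LinearMap.smul_apply, LinearMap.id_apply] at hm ⊢
  rw [pow_succ' a, mul_smul a, pow_succ' J, mul_left_comm, mul_smul J]
  exact Submodule.smul_mem_smul ha hm

theorem qPowSaturation_eq_top_iff {A M : Type} [CommRing A] [IsNoetherianRing A]
    [AddCommGroup M] [Module A M] [Module.Finite A M] (𝔮 : Ideal A) (c : ℕ) {a : A}
    (ha : a ∈ 𝔮 ^ c) (k : ℕ) :
    (qPowSaturation 𝔮 c a k : Submodule A M) = ⊤ ↔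
      ∃ l : ℕ, ∀ m : M, a ^ l • m ∈ (𝔮 ^ k * (𝔮 ^ c) ^ l) • (⊤ : Submodule A M) := by
  constructor
  · intro h
    have hlim := WellFoundedGT.iSup_eq_monotonicSequenceLimit
      (⟨_, comap_pow_smul_monotone (M := M) (𝔮 ^ k) (𝔮 ^ c) ha⟩ : ℕ →o Submodule A M)
    have htop := hlim.symm.trans h
    exact ⟨_, fun m => (Submodule.eq_top_iff'.mp htop) m⟩
  · rintro ⟨l, hl⟩
    rw [Submodule.eq_top_iff']
    exact fun m => le_iSup (fun l : ℕ => Submodule.comap ((a ^ l) • (LinearMap.id : M →ₗ[A] M))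
      ((𝔮 ^ k * (𝔮 ^ c) ^ l) • ⊤)) l (hl m)

theorem pow_smul_mem_pow_smul_top {A M : Type} [CommRing A] [AddCommGroup M] [Module A M]
    {I : Ideal A} {b : A} (hb : ∀ m : M, b • m ∈ I • (⊤ : Submodule A M)) (n : ℕ) (m : M) :
    b ^ n • m ∈ I ^ n • (⊤ : Submodule A M) := by
  induction n generalizing m with
  | zero => simp
  | succ n ih =>
    have hmap : I • (⊤ : Submodule A M) ≤
        (I ^ (n + 1) • (⊤ : Submodule A M)).comap (b ^ n • (LinearMap.id : M →ₗ[A] M)) := by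
      refine Submodule.smul_le.mpr fun r hr x _ => ?_
      simp only [Submodule.mem_comap, LinearMap.smul_apply, LinearMap.id_apply]
      rw [smul_comm, pow_succ', mul_smul]
      exact Submodule.smul_mem_smul hr (ih x)
    rw [pow_succ b, mul_smul (b ^ n)]
    exact hmap (hb m)

/-- For `a ∈ 𝔮^c`, one has `(𝔮M)^{aA} = M` iff `(𝔮^kM)^{aA} = M` for every `k ≥ 1` iff
`(𝔮^kM)^{aA} = M` for some `k ≥ 1`. -/
theorem saturation_top_iff
    {A M : Type} [CommRing A] [IsNoetherianRing A] [AddCommGroup M] [Module A M]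
    [Module.Finite A M] (𝔮 : Ideal A) (c : ℕ) (hc : 1 ≤ c) (a : A) (ha : a ∈ 𝔮 ^ c) :
    ((qPowSaturation 𝔮 c a 1 : Submodule A M) = ⊤ ↔
      ∀ k : ℕ, 1 ≤ k → (qPowSaturation 𝔮 c a k : Submodule A M) = ⊤) ∧
    ((qPowSaturation 𝔮 c a 1 : Submodule A M) = ⊤ ↔
      ∃ k : ℕ, 1 ≤ k ∧ (qPowSaturation 𝔮 c a k : Submodule A M) = ⊤) := by
  have hup : (qPowSaturation 𝔮 c a 1 : Submodule A M) = ⊤ →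
      ∀ k : ℕ, (qPowSaturation 𝔮 c a k : Submodule A M) = ⊤ := by
    intro h k
    obtain ⟨l, hl⟩ := (qPowSaturation_eq_top_iff 𝔮 c ha 1).mp h
    refine (qPowSaturation_eq_top_iff 𝔮 c ha k).mpr ⟨l * k, fun m => ?_⟩
    have hm := pow_smul_mem_pow_smul_top hl k m
    rwa [mul_pow, pow_one, ← pow_mul a, ← pow_mul (𝔮 ^ c)] at hm
  have hdown : (∃ k : ℕ, 1 ≤ k ∧ (qPowSaturation 𝔮 c a k : Submodule A M) = ⊤) →
      (qPowSaturation 𝔮 c a 1 : Submodule A M) = ⊤ := by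
    rintro ⟨k, hk, h⟩
    obtain ⟨l, hl⟩ := (qPowSaturation_eq_top_iff 𝔮 c ha k).mp h
    exact (qPowSaturation_eq_top_iff 𝔮 c ha 1).mpr ⟨l, fun m =>
      Submodule.smul_mono_left (Ideal.mul_mono_left (Ideal.pow_le_pow_right hk)) (hl m)⟩
  exact ⟨⟨fun h k _ => hup h k, fun h => h 1 le_rfl⟩,
    ⟨fun h => ⟨1, le_rfl, h⟩, hdown⟩⟩
end
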